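/- Let X be a compact metrizable topological space. The set of homeomorphisms of X, i.e., {f ∈ C(X,X) : f is bijective and f⁻¹ is continuous}, is a Gδ subset (a countable intersection of open sets) of C(X,X) with the compact-open topology. -/

import Mathlib

open Set

theorem ContinuousMap.isClosed_setOf_surjective {X Y : Type*} [TopologicalSpace X]
    [CompactSpace X] [TopologicalSpace Y] [T1Space Y] :
    IsClosed {f : C(X, Y) | Function.Surjective f} := by
  have h : {f : C(X, Y) | Function.Surjective f} =
      ⋂ y : Y, {f : C(X, Y) | range f ⊆ {y}ᶜ}ᶜ := by
    ext f
    simp [Function.Surjective, subset_compl_singleton_iff]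
  rw [h]
  exact isClosed_iInter fun y =>
    (ContinuousMap.isOpen_setOfPred_range_subset isOpen_compl_singleton).isClosed_compl

theorem ContinuousMap.isOpen_setOf_forall_mem_ne {X Y : Type*} [TopologicalSpace X]
    [LocallyCompactSpace X] [TopologicalSpace Y] [T2Space Y] {K : Set (X × X)} (hK : IsCompact K) :
    IsOpen {f : C(X, Y) | ∀ p ∈ K, f p.1 ≠ f p.2} := by
  have hc : Continuous fun f : C(X, Y) =>
      (f.comp (ContinuousMap.fst : C(X × X, X))).prodMk
        (f.comp (ContinuousMap.snd : C(X × X, X))) := by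
    refine ContinuousMap.continuous_of_continuous_uncurry _ ?_
    change Continuous fun q : C(X, Y) × (X × X) => (q.1 q.2.1, q.1 q.2.2)
    fun_prop
  exact (ContinuousMap.isOpen_setOfPred_mapsTo hK
    (isClosed_diagonal (X := Y)).isOpen_compl).preimage hc

theorem ContinuousMap.isGδ_setOf_injective {X Y : Type*} [TopologicalSpace X]
    [CompactSpace X] [TopologicalSpace.MetrizableSpace X] [TopologicalSpace Y] [T2Space Y] :
    IsGδ {f : C(X, Y) | Function.Injective f} := by
  let _ := TopologicalSpace.metrizableSpaceMetric X
  have h : {f : C(X, Y) | Function.Injective f} =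
      ⋂ n : ℕ, {f : C(X, Y) |
        ∀ p ∈ {p : X × X | 1 / ((n : ℝ) + 1) ≤ dist p.1 p.2}, f p.1 ≠ f p.2} := by
    ext f
    simp only [mem_ofPred_eq, mem_iInter]
    refine ⟨fun hf n p hp hfp => ?_, fun hf x y hxy => ?_⟩
    · rw [hf hfp, dist_self] at hp
      exact hp.not_gt Nat.one_div_pos_of_nat
    · by_contra hne
      obtain ⟨n, hn⟩ := exists_nat_one_div_lt (dist_pos.2 hne)
      exact hf n (x, y) hn.le hxy
  rw [h]
  exact IsGδ.iInter_of_isOpen fun n => isOpen_setOf_forall_mem_ne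
    (isClosed_le continuous_const continuous_dist).isCompact

/-- For a compact metrizable space `X`, the set of homeomorphisms of `X` is a `Gδ` subset of
`C(X,X)` with the compact-open topology. -/
theorem homeomorphisms_isGδ (X : Type*) [TopologicalSpace X] [CompactSpace X]
    [TopologicalSpace.MetrizableSpace X] :
    IsGδ {f : C(X, X) | IsHomeomorph ⇑f} := by
  let _ := TopologicalSpace.metrizableSpaceMetric X
  have h : {f : C(X, X) | IsHomeomorph ⇑f} =
      {f : C(X, X) | Function.Injective f} ∩ {f : C(X, X) | Function.Surjective f} := by
    ext f
    simp [isHomeomorph_iff_continuous_bijective, Function.Bijective, f.continuous]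
  rw [h]
  exact ContinuousMap.isGδ_setOf_injective.inter
    ContinuousMap.isClosed_setOf_surjective.isGδ
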